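/- Let T = [[a,b],[c,d]] and T' be J-unitary operators on K and let u be a bounded operator on H with ‖u‖ ≤ 1. Then cu + d is invertible, so the Möbius transform T·u := (au + b)(cu + d)^{-1} is well defined. If ‖u‖ < 1 then ‖T·u‖ < 1; if u is unitary then T·u is unitary; and (TT')·u = T·(T'·u). -/

import Mathlib

noncomputable section

open ContinuousLinearMap

variable {H : Type*} [NormedAddCommGroup H] [InnerProductSpace ℂ H] [CompleteSpace H]
  [TopologicalSpace.SeparableSpace H]

local notation "K" => WithLp 2 (H × H)

/-- The 2×2 block operator `[[a,b],[c,d]]` on `K = H ⊕ H`. -/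
def blk (a b c d : H →L[ℂ] H) : K →L[ℂ] K :=
  (((WithLp.prodContinuousLinearEquiv 2 ℂ H H).symm : (H × H) →L[ℂ] K).comp
      ((((a.comp (fst ℂ H H)) + (b.comp (snd ℂ H H))).prod
        ((c.comp (fst ℂ H H)) + (d.comp (snd ℂ H H)))))).comp
    ((WithLp.prodContinuousLinearEquiv 2 ℂ H H : K →L[ℂ] (H × H)))

/-- The fundamental symmetry `J = [[1,0],[0,-1]]`. -/
def fundJ : K →L[ℂ] K := blk 1 0 0 (-1)

/-- A bounded operator `T` on the Krein space `(K, J)` is `J`-unitary if it is invertible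
and `T* J T = J`. -/
def IsJUnitary (T : K →L[ℂ] K) : Prop :=
  IsUnit T ∧ star T * fundJ * T = fundJ

/-- The Möbius transform `T·u = (au + b)(cu + d)⁻¹` of `u` under the block operator
`T = [[a,b],[c,d]]`. -/
def moebius (a b c d u : H →L[ℂ] H) : H →L[ℂ] H :=
  (a * u + b) * Ring.inverse (c * u + d)

section MoebiusAux

variable {E : Type*} [NormedAddCommGroup E] [InnerProductSpace ℂ E]

theorem blk_apply (a b c d : E →L[ℂ] E) (x : WithLp 2 (E × E)) :
    blk a b c d x = WithLp.toLp 2 (a x.fst + b x.snd, c x.fst + d x.snd) := rfl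

theorem blk_mul (a b c d a' b' c' d' : E →L[ℂ] E) :
    blk a b c d * blk a' b' c' d' =
      blk (a * a' + b * c') (a * b' + b * d') (c * a' + d * c') (c * b' + d * d') := by
  refine ContinuousLinearMap.ext fun x => ?_
  simp only [mul_apply_eq_comp, blk_apply, add_apply, map_add, WithLp.toLp.injEq, Prod.mk.injEq,
    WithLp.fst, WithLp.snd]
  constructor <;> abel

theorem blk_one : blk (1 : E →L[ℂ] E) 0 0 1 = 1 := by
  refine ContinuousLinearMap.ext fun x => ?_
  simp only [blk_apply, one_apply_eq_self, zero_apply, add_zero, zero_add]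
  rfl

theorem blk_inj {a b c d a' b' c' d' : E →L[ℂ] E} (h : blk a b c d = blk a' b' c' d') :
    a = a' ∧ b = b' ∧ c = c' ∧ d = d' := by
  have key (x y : E) : a x + b y = a' x + b' y ∧ c x + d y = c' x + d' y := by
    have := congrArg (fun f => f (WithLp.toLp 2 (x, y))) h
    simpa only [blk_apply, WithLp.toLp.injEq, Prod.mk.injEq, WithLp.fst, WithLp.snd] using this
  exact ⟨ContinuousLinearMap.ext fun x => by simpa using (key x 0).1,
    ContinuousLinearMap.ext fun x => by simpa using (key 0 x).1,
    ContinuousLinearMap.ext fun x => by simpa using (key x 0).2,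
    ContinuousLinearMap.ext fun x => by simpa using (key 0 x).2⟩

theorem fundJ_mul_self : (fundJ : WithLp 2 (E × E) →L[ℂ] _) * fundJ = 1 := by
  rw [fundJ, blk_mul, ← blk_one]
  simp

/-- If `‖A x‖² + δ ‖B x‖² ≤ ‖x‖²` with `B` bounded below, then `A` is a strict contraction. -/
theorem norm_lt_one_of_sq_add_le {A B C : E →L[ℂ] E} {δ : ℝ} (hδ : 0 < δ) (hCB : C * B = 1)
    (h : ∀ x, ‖A x‖ ^ 2 + δ * ‖B x‖ ^ 2 ≤ ‖x‖ ^ 2) : ‖A‖ < 1 := by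
  set m : ℝ := ‖C‖ + 1
  have hm : 0 < m := by positivity
  have hB (x : E) : ‖x‖ ^ 2 / m ^ 2 ≤ ‖B x‖ ^ 2 := by
    rw [div_le_iff₀ (by positivity), ← mul_pow]
    gcongr
    calc ‖x‖ = ‖C (B x)‖ := by rw [← mul_apply_eq_comp, hCB, one_apply_eq_self]
      _ ≤ ‖C‖ * ‖B x‖ := C.le_opNorm _
      _ ≤ ‖B x‖ * m := by nlinarith [norm_nonneg (B x)]
  have hb : ‖A‖ ≤ √(1 - δ / m ^ 2) := by
    refine A.opNorm_le_bound (Real.sqrt_nonneg _) fun x => ?_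
    have hx : ‖A x‖ ^ 2 ≤ (1 - δ / m ^ 2) * ‖x‖ ^ 2 := by
      have := mul_le_mul_of_nonneg_left (hB x) hδ.le
      have e : δ * (‖x‖ ^ 2 / m ^ 2) = δ / m ^ 2 * ‖x‖ ^ 2 := by ring
      linarith [h x]
    calc ‖A x‖ = √(‖A x‖ ^ 2) := (Real.sqrt_sq (norm_nonneg _)).symm
      _ ≤ √((1 - δ / m ^ 2) * ‖x‖ ^ 2) := Real.sqrt_le_sqrt hx
      _ = √(1 - δ / m ^ 2) * ‖x‖ := by
        rw [Real.sqrt_mul' _ (sq_nonneg _), Real.sqrt_sq (norm_nonneg _)]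
  refine hb.trans_lt ?_
  rw [Real.sqrt_lt' one_pos]
  linarith [show 0 < δ / m ^ 2 by positivity]

theorem moebius_mul {a b c d a' b' c' d' u : E →L[ℂ] E} (hu : IsUnit (c' * u + d')) :
    moebius (a * a' + b * c') (a * b' + b * d') (c * a' + d * c') (c * b' + d * d') u =
      moebius a b c d (moebius a' b' c' d' u) := by
  obtain ⟨n, hn⟩ := hu
  have key (p q : E →L[ℂ] E) : (p * a' + q * c') * u + (p * b' + q * d') =
      (p * moebius a' b' c' d' u + q) * n := by
    rw [moebius, ← hn, Ring.inverse_unit, add_mul _ q, mul_assoc p, mul_assoc (a' * u + b'),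
      Units.inv_mul, mul_one, hn]
    noncomm_ring
  have hinv (x : E →L[ℂ] E) : Ring.inverse (x * n) = ↑n⁻¹ * Ring.inverse x := by
    by_cases hx : IsUnit x
    · obtain ⟨w, rfl⟩ := hx
      rw [← Units.val_mul, Ring.inverse_unit, Ring.inverse_unit, mul_inv_rev, Units.val_mul]
    · rw [Ring.inverse_non_unit _ hx, Ring.inverse_non_unit _ (by simpa using hx), mul_zero]
  rw [moebius, key, key, hinv, mul_assoc, Units.mul_inv_cancel_left]
  rfl

variable [CompleteSpace E]

theorem star_blk (a b c d : E →L[ℂ] E) :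
    star (blk a b c d) = blk (star a) (star c) (star b) (star d) := by
  rw [star_eq_adjoint, eq_comm, eq_adjoint_iff]
  intro x y
  simp only [blk_apply, WithLp.prod_inner_apply, star_eq_adjoint, inner_add_left,
    inner_add_right, adjoint_inner_left, WithLp.fst, WithLp.snd]
  ring

theorem IsJUnitary.mul_fundJ_mul_star {T : WithLp 2 (E × E) →L[ℂ] WithLp 2 (E × E)}
    (h : IsJUnitary T) : T * fundJ * star T = fundJ := by
  obtain ⟨⟨v, rfl⟩, h⟩ := h
  set J : WithLp 2 (E × E) →L[ℂ] WithLp 2 (E × E) := fundJ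
  have hJ : J * J = 1 := fundJ_mul_self
  have hinv : J * star (v : WithLp 2 (E × E) →L[ℂ] WithLp 2 (E × E)) * J = ↑v⁻¹ := by
    rw [← Units.mul_eq_one_iff_eq_inv, mul_assoc, mul_assoc, ← mul_assoc (star _), h,
      hJ]
  calc _ = v * (J * star (v : WithLp 2 (E × E) →L[ℂ] WithLp 2 (E × E)) * J) * J := by
        simp only [mul_assoc, hJ, mul_one]
    _ = J := by rw [hinv, Units.mul_inv, one_mul]

/-- The entrywise form of `T* J T = J`. -/
theorem IsJUnitary.star_mul_relations {a b c d : E →L[ℂ] E} (h : IsJUnitary (blk a b c d)) :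
    star a * a = 1 + star c * c ∧ star a * b = star c * d ∧
      star b * a = star d * c ∧ star d * d = 1 + star b * b := by
  have h := h.2
  rw [star_blk, fundJ, blk_mul, blk_mul] at h
  obtain ⟨h1, h2, h3, h4⟩ := blk_inj h
  simp only [mul_one, mul_zero, add_zero, zero_sub, mul_neg, neg_mul, ← sub_eq_add_neg]
    at h1 h2 h3 h4
  exact ⟨sub_eq_iff_eq_add.1 h1, sub_eq_zero.1 h2, sub_eq_zero.1 h3,
    by rw [sub_eq_iff_eq_add] at h4; rw [h4]; abel⟩

/-- The diagonal entries of `T J T* = J`. -/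
theorem IsJUnitary.mul_star_relations {a b c d : E →L[ℂ] E} (h : IsJUnitary (blk a b c d)) :
    a * star a = 1 + b * star b ∧ d * star d = 1 + c * star c := by
  have h := h.mul_fundJ_mul_star
  rw [star_blk, fundJ, blk_mul, blk_mul] at h
  obtain ⟨h1, -, -, h4⟩ := blk_inj h
  simp only [mul_one, mul_zero, add_zero, zero_sub, mul_neg, neg_mul, ← sub_eq_add_neg]
    at h1 h4
  exact ⟨sub_eq_iff_eq_add.1 h1, by rw [sub_eq_iff_eq_add] at h4; rw [h4]; abel⟩

theorem re_inner_star_mul_self_apply (A : E →L[ℂ] E) (x : E) :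
    (inner ℂ ((star A * A) x) x).re = ‖A x‖ ^ 2 :=
  (apply_norm_sq_eq_inner_adjoint_left A x).symm

theorem norm_sq_add_norm_sq_of_star_mul_self {A B C D : E →L[ℂ] E}
    (h : star A * A + star B * B = star C * C + star D * D) (x : E) :
    ‖A x‖ ^ 2 + ‖B x‖ ^ 2 = ‖C x‖ ^ 2 + ‖D x‖ ^ 2 := by
  simp only [← re_inner_star_mul_self_apply, ← Complex.add_re, ← inner_add_left, ← add_apply, h]

theorem isUnit_one_add_star_mul_self (q : E →L[ℂ] E) : IsUnit (1 + star q * q) :=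
  CStarAlgebra.isUnit_of_le 1 (le_add_of_nonneg_right (star_mul_self_nonneg q))

theorem isUnit_add_mul_of_relations {p q r u : E →L[ℂ] E} (h₁ : star p * p = 1 + star q * q)
    (h₂ : p * star p = 1 + r * star r) (hu : ‖u‖ ≤ 1) : IsUnit (p + r * u) := by
  have hp : IsUnit p := by
    have hl : IsUnit (star p * p) := h₁ ▸ isUnit_one_add_star_mul_self q
    have hr : IsUnit (p * star p) := by
      rw [h₂]
      simpa using isUnit_one_add_star_mul_self (star r)
    obtain ⟨x, hx⟩ := hl.exists_left_inv
    obtain ⟨y, hy⟩ := hr.exists_right_inv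
    exact isUnit_iff_exists_and_exists.2
      ⟨⟨star p * y, by rw [← mul_assoc, hy]⟩, ⟨x * star p, by rw [mul_assoc, hx]⟩⟩
  obtain ⟨v, rfl⟩ := hp
  set e : E →L[ℂ] E := ↑v⁻¹ * r with he
  set w : E →L[ℂ] E := star (↑v⁻¹ : E →L[ℂ] E) with hw
  have hvw : star (v : E →L[ℂ] E) * w = 1 := by rw [hw, ← star_mul, Units.inv_mul, star_one]
  have hee : star (star e) * star e + star w * w = star 1 * 1 + star 0 * 0 := by
    calc _ = ↑v⁻¹ * (1 + r * star r) * w := by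
          simp only [he, hw, star_star, star_mul]
          noncomm_ring
      _ = 1 := by
          rw [← h₂, ← mul_assoc, Units.inv_mul, one_mul, hvw]
      _ = _ := by simp
  have hlt : ‖e‖ < 1 := by
    rw [← norm_star]
    refine norm_lt_one_of_sq_add_le one_pos hvw fun x => ?_
    simpa using (norm_sq_add_norm_sq_of_star_mul_self hee x).le
  have h1 : IsUnit (1 + e * u) := by
    rw [← sub_neg_eq_add]
    refine isUnit_one_sub_of_norm_lt_one ?_
    rw [norm_neg]
    exact calc ‖e * u‖ ≤ ‖e‖ * ‖u‖ := norm_mul_le e u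
      _ ≤ ‖e‖ := mul_le_of_le_one_right (norm_nonneg _) hu
      _ < 1 := hlt
  have heq : (v : E →L[ℂ] E) + r * u = v * (1 + e * u) := by
    simp [he, mul_add, ← mul_assoc]
  rw [heq]
  exact v.isUnit.mul h1

theorem IsJUnitary.isUnit_denom {a b c d u : E →L[ℂ] E} (h : IsJUnitary (blk a b c d))
    (hu : ‖u‖ ≤ 1) : IsUnit (c * u + d) := by
  rw [add_comm]
  exact isUnit_add_mul_of_relations h.star_mul_relations.2.2.2 h.mul_star_relations.2 hu

theorem IsJUnitary.star_num_mul_num {a b c d : E →L[ℂ] E} (h : IsJUnitary (blk a b c d))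
    (u : E →L[ℂ] E) :
    star (a * u + b) * (a * u + b) + star 1 * 1 =
      star (c * u + d) * (c * u + d) + star u * u := by
  obtain ⟨h1, h2, h3, h4⟩ := h.star_mul_relations
  have expand (p q : E →L[ℂ] E) : star (p * u + q) * (p * u + q) =
      star u * (star p * p) * u + star u * (star p * q) + star q * p * u + star q * q := by
    rw [star_add, star_mul]
    noncomm_ring
  rw [expand, expand, h1, h2, h3, h4, star_one]
  noncomm_ring

theorem IsJUnitary.norm_moebius_lt_one {a b c d u : E →L[ℂ] E} (h : IsJUnitary (blk a b c d))
    (hu : ‖u‖ < 1) : ‖moebius a b c d u‖ < 1 := by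
  obtain ⟨n, hn⟩ := h.isUnit_denom hu.le
  rw [moebius, ← hn, Ring.inverse_unit]
  refine norm_lt_one_of_sq_add_le (δ := 1 - ‖u‖ ^ 2) (by nlinarith [norm_nonneg u]) n.mul_inv
    fun x => ?_
  have key := norm_sq_add_norm_sq_of_star_mul_self (h.star_num_mul_num u)
    ((↑n⁻¹ : E →L[ℂ] E) x)
  rw [← hn, ← mul_apply_eq_comp (n : E →L[ℂ] E), Units.mul_inv, one_apply_eq_self,
    one_apply_eq_self] at key
  have hux : ‖u ((↑n⁻¹ : E →L[ℂ] E) x)‖ ^ 2 ≤ ‖u‖ ^ 2 * ‖(↑n⁻¹ : E →L[ℂ] E) x‖ ^ 2 := by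
    rw [← mul_pow]
    gcongr
    exact u.le_opNorm _
  rw [mul_apply_eq_comp]
  linarith

theorem IsJUnitary.moebius_mem_unitary {a b c d u : E →L[ℂ] E} (h : IsJUnitary (blk a b c d))
    (hu : ‖u‖ ≤ 1) (huu : u ∈ unitary (E →L[ℂ] E)) :
    moebius a b c d u ∈ unitary (E →L[ℂ] E) := by
  have hnum : IsUnit (a * u + b) := by
    have heq : a * u + b = (a + b * star u) * u := by
      rw [add_mul, mul_assoc b, Unitary.star_mul_self_of_mem huu, mul_one]
    rw [heq]
    exact (isUnit_add_mul_of_relations h.star_mul_relations.1 h.mul_star_relations.1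
      (by rwa [norm_star])).mul (Unitary.toUnits ⟨u, huu⟩).isUnit
  have hrel := h.star_num_mul_num u
  rw [Unitary.star_mul_self_of_mem huu, star_one, one_mul, add_left_inj] at hrel
  obtain ⟨n, hn⟩ := h.isUnit_denom hu
  obtain ⟨p, hp⟩ := hnum
  rw [← hn, ← hp] at hrel
  rw [moebius, ← hn, ← hp, Ring.inverse_unit, ← Units.val_mul]
  have hs : star (↑(p * n⁻¹) : E →L[ℂ] E) * ↑(p * n⁻¹) = 1 := by
    calc _ = star (↑n⁻¹ : E →L[ℂ] E) * (star (p : E →L[ℂ] E) * p) * ↑n⁻¹ := by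
          simp only [Units.val_mul, star_mul, mul_assoc]
      _ = star ((n : E →L[ℂ] E) * ↑n⁻¹) * (n * ↑n⁻¹) := by
          rw [hrel, star_mul]
          simp only [mul_assoc]
      _ = 1 := by rw [Units.mul_inv, star_one, one_mul]
  refine Unitary.mem_iff.2 ⟨hs, ?_⟩
  rw [Units.mul_eq_one_iff_eq_inv.1 hs, Units.mul_inv]

end MoebiusAux

/-- Theorem 3.2 of the paper: `J`-unitaries act by Möbius transformations
on the closed unit ball of `B(H)`, preserving the open ball and the unitary group, and the
action is compatible with composition. -/
theorem moebius_action (a b c d a' b' c' d' : H →L[ℂ] H)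
    (hT : IsJUnitary (blk a b c d)) (hT' : IsJUnitary (blk a' b' c' d'))
    (u : H →L[ℂ] H) (hu : ‖u‖ ≤ 1) :
    -- cu + d is invertible, so T·u is well defined
    IsUnit (c * u + d) ∧
    -- strict contraction on the open unit ball
    (‖u‖ < 1 → ‖moebius a b c d u‖ < 1) ∧
    -- preservation of the unitary group
    (u ∈ unitary (H →L[ℂ] H) → moebius a b c d u ∈ unitary (H →L[ℂ] H)) ∧
    -- compatibility with composition: (TT')·u = T·(T'·u)
    (∀ a'' b'' c'' d'' : H →L[ℂ] H,
      blk a'' b'' c'' d'' = blk a b c d * blk a' b' c' d' →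
      moebius a'' b'' c'' d'' u = moebius a b c d (moebius a' b' c' d' u)) := by
  refine ⟨hT.isUnit_denom hu, hT.norm_moebius_lt_one, hT.moebius_mem_unitary hu, ?_⟩
  intro a'' b'' c'' d'' h
  rw [blk_mul] at h
  obtain ⟨rfl, rfl, rfl, rfl⟩ := blk_inj h
  exact moebius_mul (hT'.isUnit_denom hu)
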